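/- arXiv:1501.07812 — 2 statements merged into one kernel-verified Lean document; each statement's English description precedes it below -/
import Mathlib

section
/- Let n ≥ 3, Z ∈ ℂ^{2×2}, Ŝ ∈ ℂ^{(n−1)×(n−1)}, and set S = (Z ⊕ I_{n−2})(1 ⊕ Ŝ). Let A ∈ ℂ^{n×n} and let Â = A[2:n, 2:n] be its trailing principal submatrix of size n−1. Then there exists W ∈ ℂ^{2×2} such that t(SAS^*) − S t(A) S^* = W ⊕ 0_{n−2} + (Z ⊕ I_{n−2}) (0 ⊕ (t(ŜÂŜ^*) − Ŝ t(Â) Ŝ^*)) (Z^* ⊕ I_{n−2}), where 0 ⊕ M denotes the n×n matrix with a zero first row and column and trailing block M. -/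
open Matrix BigOperators

/-- The operator `t`: `t(A)_{ij} = A_{ij}` for `i > j`, `conj (A_{ji})` for
`i < j`, and `0` on the diagonal. -/
noncomputable def tOp {n : ℕ} (A : Matrix (Fin n) (Fin n) ℂ) :
    Matrix (Fin n) (Fin n) ℂ :=
  Matrix.of fun i j =>
    if j < i then A i j else if i < j then (starRingEnd ℂ) (A j i) else 0

theorem tOp_oneS {m : ℕ} (P A : Matrix (Fin (m+1)) (Fin (m+1)) ℂ)
    (T Ah : Matrix (Fin m) (Fin m) ℂ) (E : Matrix (Fin (m+1)) (Fin (m+1)) ℂ)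
    (h00 : P 0 0 = 1) (h0 : ∀ j : Fin m, P 0 j.succ = 0) (h1 : ∀ i : Fin m, P i.succ 0 = 0)
    (hP : ∀ i j : Fin m, P i.succ j.succ = T i j)
    (hA : ∀ i j : Fin m, A i.succ j.succ = Ah i j)
    (e0 : ∀ j, E 0 j = 0) (e1 : ∀ i, E i 0 = 0)
    (hE : ∀ i j : Fin m, E i.succ j.succ = (tOp (T * Ah * Tᴴ) - T * tOp Ah * Tᴴ) i j) :
    tOp (P * A * Pᴴ) = P * tOp A * Pᴴ + E := by
  have k00 : ∀ X : Matrix (Fin (m+1)) (Fin (m+1)) ℂ, (P * X * Pᴴ) 0 0 = X 0 0 := by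
    intro X
    simp [Matrix.mul_apply, Fin.sum_univ_succ, h00, h0]
  have k10 : ∀ (X : Matrix (Fin (m+1)) (Fin (m+1)) ℂ) (i : Fin m),
      (P * X * Pᴴ) i.succ 0 = ∑ l, T i l * X l.succ 0 := by
    intro X i
    simp [Matrix.mul_apply, Fin.sum_univ_succ, h00, h0, h1, hP]
  have k01 : ∀ (X : Matrix (Fin (m+1)) (Fin (m+1)) ℂ) (i : Fin m),
      (P * X * Pᴴ) 0 i.succ = ∑ l, X 0 l.succ * star (T i l) := by
    intro X i
    simp [Matrix.mul_apply, Fin.sum_univ_succ, h00, h0, h1, hP]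
  have k11 : ∀ (X : Matrix (Fin (m+1)) (Fin (m+1)) ℂ) (Y : Matrix (Fin m) (Fin m) ℂ)
      (_ : ∀ i j, X i.succ j.succ = Y i j) (i j : Fin m),
      (P * X * Pᴴ) i.succ j.succ = (T * Y * Tᴴ) i j := by
    intro X Y h i j
    simp [Matrix.mul_apply, Fin.sum_univ_succ, h1, hP, h]
  have tA : ∀ i j : Fin m, tOp A i.succ j.succ = tOp Ah i j := by
    intro i j
    simp [tOp, hA]
  ext p q
  rw [Matrix.add_apply]
  refine Fin.cases ?_ (fun i => ?_) p <;> refine Fin.cases ?_ (fun j => ?_) q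
  · rw [k00, e0]; simp [tOp]
  · rw [k01, e0]
    simp only [tOp, Matrix.of_apply, k10]
    simp [mul_comm]
  · rw [k10, e1]
    simp only [tOp, Matrix.of_apply, k10]
    simp
  · rw [k11 _ _ tA, hE]
    simp only [tOp, Matrix.of_apply, k11 _ _ hA, Matrix.sub_apply]
    simp

theorem tOp_ZI {n : ℕ} (P B : Matrix (Fin n) (Fin n) ℂ)
    (h0 : ∀ p q : Fin n, (p : ℕ) < 2 → ¬ (q : ℕ) < 2 → P p q = 0)
    (h1 : ∀ p q : Fin n, ¬ (p : ℕ) < 2 → P p q = if p = q then 1 else 0)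
    (p q : Fin n) (h : ¬ ((p : ℕ) < 2 ∧ (q : ℕ) < 2)) :
    tOp (P * B * Pᴴ) p q = (P * tOp B * Pᴴ) p q := by
  have kl : ∀ (X : Matrix (Fin n) (Fin n) ℂ) (p q : Fin n), ¬ (p : ℕ) < 2 →
      (P * X * Pᴴ) p q = ∑ l, X p l * star (P q l) := by
    intro X p q hp
    simp [Matrix.mul_apply, h1 p _ hp]
  have kr : ∀ (X : Matrix (Fin n) (Fin n) ℂ) (p q : Fin n), ¬ (q : ℕ) < 2 →
      (P * X * Pᴴ) p q = ∑ l, P p l * X l q := by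
    intro X p q hq
    simp [Matrix.mul_apply, h1 q _ hq]
  by_cases hp : (p : ℕ) < 2
  · have hq : ¬ (q : ℕ) < 2 := fun hq => h ⟨hp, hq⟩
    rw [kr _ _ _ hq]
    have hpq : p < q := by rw [Fin.lt_def]; omega
    simp only [tOp, Matrix.of_apply, if_pos hpq, if_neg hpq.not_gt, kl _ _ _ hq, map_sum]
    refine Finset.sum_congr rfl fun l _ => ?_
    by_cases hl : (l : ℕ) < 2
    · have hlq : l < q := by rw [Fin.lt_def]; omega
      simp [if_pos hlq, if_neg hlq.not_gt, mul_comm]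
    · simp [h0 p l hp hl]
  · by_cases hq : (q : ℕ) < 2
    · rw [kl _ _ _ hp]
      have hpq : q < p := by rw [Fin.lt_def]; omega
      simp only [tOp, Matrix.of_apply, if_pos hpq, kl _ _ _ hp]
      refine Finset.sum_congr rfl fun l _ => ?_
      by_cases hl : (l : ℕ) < 2
      · have hlq : l < p := by rw [Fin.lt_def]; omega
        simp [if_pos hlq]
      · simp [h0 q l hq hl]
    · have kk : ∀ (X : Matrix (Fin n) (Fin n) ℂ) (p q : Fin n), ¬ (p : ℕ) < 2 →
          ¬ (q : ℕ) < 2 → (P * X * Pᴴ) p q = X p q := by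
        intro X p q hp hq
        rw [kl _ _ _ hp]
        simp [h1 q _ hq]
      rw [kk _ _ _ hp hq]
      simp only [tOp, Matrix.of_apply, kk _ _ _ hp hq, kk _ _ _ hq hp]

/-- For `S = (Z ⊕ I_{n-2})(1 ⊕ Ŝ)` and `Â = A[2:n, 2:n]`, there exists
`W ∈ ℂ^{2×2}` with
`t(SASᴴ) - S t(A) Sᴴ
  = W ⊕ 0_{n-2} + (Z ⊕ I_{n-2}) (0 ⊕ (t(ŜÂŜᴴ) - Ŝ t(Â) Ŝᴴ)) (Zᴴ ⊕ I_{n-2})`. -/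
theorem stmt_9 (n : ℕ) (hn : 3 ≤ n)
    (Z : Matrix (Fin 2) (Fin 2) ℂ)
    (Shat : Matrix (Fin (n - 1)) (Fin (n - 1)) ℂ)
    (A : Matrix (Fin n) (Fin n) ℂ) :
    -- `ZI = Z ⊕ I_{n-2}`
    let ZI : Matrix (Fin n) (Fin n) ℂ := Matrix.of fun p q =>
      if hp : (p : ℕ) < 2 then
        (if hq : (q : ℕ) < 2 then Z ⟨p, hp⟩ ⟨q, hq⟩ else 0)
      else if p = q then 1 else 0
    -- `oneS = 1 ⊕ Ŝ`
    let oneS : Matrix (Fin n) (Fin n) ℂ := Matrix.of fun p q =>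
      if hp : (p : ℕ) = 0 then (if (q : ℕ) = 0 then 1 else 0)
      else if hq : (q : ℕ) = 0 then 0
      else Shat ⟨(p : ℕ) - 1, by have := p.2; omega⟩
                ⟨(q : ℕ) - 1, by have := q.2; omega⟩
    -- `emb M = 0 ⊕ M` (zero first row and column)
    let emb : Matrix (Fin (n - 1)) (Fin (n - 1)) ℂ → Matrix (Fin n) (Fin n) ℂ :=
      fun M => Matrix.of fun p q =>
        if hp : (p : ℕ) = 0 then 0
        else if hq : (q : ℕ) = 0 then 0
        else M ⟨(p : ℕ) - 1, by have := p.2; omega⟩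
               ⟨(q : ℕ) - 1, by have := q.2; omega⟩
    -- `Â = A[2:n, 2:n]`
    let Ahat : Matrix (Fin (n - 1)) (Fin (n - 1)) ℂ := Matrix.of fun p q =>
      A ⟨(p : ℕ) + 1, by have := p.2; omega⟩ ⟨(q : ℕ) + 1, by have := q.2; omega⟩
    let S : Matrix (Fin n) (Fin n) ℂ := ZI * oneS
    ∃ W : Matrix (Fin 2) (Fin 2) ℂ,
      tOp (S * A * Sᴴ) - S * tOp A * Sᴴ =
        (Matrix.of fun (p q : Fin n) =>
          if hp : (p : ℕ) < 2 then
            (if hq : (q : ℕ) < 2 then W ⟨p, hp⟩ ⟨q, hq⟩ else 0)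
          else 0) +
        ZI * emb (tOp (Shat * Ahat * Shatᴴ) - Shat * tOp Ahat * Shatᴴ) * ZIᴴ := by
  intro ZI oneS emb Ahat S
  obtain ⟨m, rfl⟩ : ∃ m, n = m + 1 := ⟨n - 1, by omega⟩
  set E := emb (tOp (Shat * Ahat * Shatᴴ) - Shat * tOp Ahat * Shatᴴ) with hE
  have L1 : tOp (oneS * A * oneSᴴ) = oneS * tOp A * oneSᴴ + E := by
    refine tOp_oneS (m := m) oneS A Shat Ahat E ?_ ?_ ?_ ?_ ?_ ?_ ?_ ?_
    · simp [oneS]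
    · intro j; simp [oneS]
    · intro j; simp [oneS]
    · intro i j; simp [oneS]
    · intro i j; rfl
    · intro j; simp [E, emb]
    · intro j; simp [E, emb]
    · intro i j; simp [E, emb]
  have L2 := tOp_ZI ZI (oneS * A * oneSᴴ)
    (by intro p q hp hq; simp only [ZI, Matrix.of_apply, dif_pos hp, dif_neg hq])
    (by intro p q hp; simp only [ZI, Matrix.of_apply, dif_neg hp])
  have hS : ∀ X, S * X * Sᴴ = ZI * (oneS * X * oneSᴴ) * ZIᴴ := by
    intro X
    simp only [S, Matrix.conjTranspose_mul, Matrix.mul_assoc]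
  have hD : ∀ p q : Fin (m+1), ¬ ((p : ℕ) < 2 ∧ (q : ℕ) < 2) →
      (tOp (S * A * Sᴴ) - S * tOp A * Sᴴ) p q = (ZI * E * ZIᴴ) p q := by
    intro p q h
    rw [hS, hS, Matrix.sub_apply, L2 p q h, L1, Matrix.mul_add, Matrix.add_mul,
      Matrix.add_apply]
    ring
  refine ⟨Matrix.of fun i j =>
    (tOp (S * A * Sᴴ) - S * tOp A * Sᴴ - ZI * E * ZIᴴ) ⟨i, by omega⟩ ⟨j, by omega⟩, ?_⟩
  ext p q
  rw [Matrix.add_apply]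
  by_cases hp : (p : ℕ) < 2
  · by_cases hq : (q : ℕ) < 2
    · simp only [Matrix.of_apply, dif_pos hp, dif_pos hq]
      simp only [Matrix.sub_apply]
      ring
    · rw [hD p q (by tauto)]
      simp only [Matrix.of_apply, dif_pos hp, dif_neg hq, zero_add]
  · rw [hD p q (by tauto)]
    simp only [Matrix.of_apply, dif_neg hp, zero_add]
end

section
/- Let A = D + UV^* ∈ ℂ^{n×n} with D a real diagonal matrix and U, V ∈ ℂ^{n×k}, let Q ∈ ℂ^{n×n} be unitary, and suppose H = QAQ^* is upper Hessenberg. Then H is (1, 2k+1)-quasiseparable: rank(H[i+1:n, 1:i]) ≤ 1 and rank(H[1:i, i+1:n]) ≤ 2k+1 for every i = 1,…,n−1. -/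
open Matrix BigOperators

/-- `A` is lower-quasiseparable of rank `k`. -/
noncomputable def lowQS {n : ℕ} (k : ℕ) (A : Matrix (Fin n) (Fin n) ℂ) : Prop :=
  ∀ i : ℕ, ∀ _hi : 0 < i, ∀ _hin : i < n,
    (Matrix.of fun (p : Fin (n - i)) (q : Fin i) =>
      A ⟨i + p.1, by have := p.2; omega⟩ ⟨q.1, by have := q.2; omega⟩).rank ≤ k

/-- `A` is upper-quasiseparable of rank `k`. -/
noncomputable def upQS {n : ℕ} (k : ℕ) (A : Matrix (Fin n) (Fin n) ℂ) : Prop :=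
  ∀ i : ℕ, ∀ _hi : 0 < i, ∀ _hin : i < n,
    (Matrix.of fun (p : Fin i) (q : Fin (n - i)) =>
      A ⟨p.1, by have := p.2; omega⟩ ⟨i + q.1, by have := q.2; omega⟩).rank ≤ k

theorem rank_add_le_aux {m n : Type*} [Fintype m] [Fintype n] (A B : Matrix m n ℂ) :
    (A + B).rank ≤ A.rank + B.rank := by
  unfold Matrix.rank
  rw [Matrix.mulVecLin_add]
  calc _ ≤ Module.finrank ℂ
        (LinearMap.range A.mulVecLin ⊔ LinearMap.range B.mulVecLin : Submodule ℂ (m → ℂ)) := by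
        apply Submodule.finrank_mono
        rintro _ ⟨x, rfl⟩
        exact Submodule.add_mem_sup ⟨x, rfl⟩ ⟨x, rfl⟩
    _ ≤ _ := Submodule.finrank_add_le_finrank_add_finrank _ _

theorem rank_sub_mul_le_aux {n k a b : ℕ} (X : Matrix (Fin n) (Fin k) ℂ)
    (Y : Matrix (Fin k) (Fin n) ℂ) (f : Fin a → Fin n) (g : Fin b → Fin n) :
    ((X * Y).submatrix f g).rank ≤ k :=
  (Matrix.rank_submatrix_le _ _ _).trans
    ((Matrix.rank_mul_le_left _ _).trans (Matrix.rank_le_width _))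

/-- If `A = D + UVᴴ` with `D` real diagonal, `Q` unitary and `H = QAQᴴ` is
upper Hessenberg, then `H` is `(1, 2k+1)`-quasiseparable. -/
theorem stmt_13 (n k : ℕ) (dd : Fin n → ℝ) (U V : Matrix (Fin n) (Fin k) ℂ)
    (Q : Matrix (Fin n) (Fin n) ℂ) (hQ : Q ∈ Matrix.unitaryGroup (Fin n) ℂ)
    (H : Matrix (Fin n) (Fin n) ℂ)
    (hH : H = Q * (Matrix.diagonal (fun i => (dd i : ℂ)) + U * Vᴴ) * Qᴴ)
    (hHess : ∀ i j : Fin n, (j : ℕ) + 1 < (i : ℕ) → H i j = 0) :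
    lowQS 1 H ∧ upQS (2 * k + 1) H := by
  have hlow : lowQS 1 H := by
    intro i hi hin
    have : (Matrix.of fun (p : Fin (n - i)) (q : Fin i) =>
        H ⟨i + p.1, by have := p.2; omega⟩ ⟨q.1, by have := q.2; omega⟩) =
        Matrix.vecMulVec
          (fun p : Fin (n - i) => if p.1 = 0 then H ⟨i, hin⟩ ⟨i - 1, by omega⟩ else 0)
          (fun q : Fin i => if q.1 = i - 1 then 1 else 0) := by
      ext p q
      simp only [Matrix.of_apply, Matrix.vecMulVec_apply]
      have hq := q.2
      by_cases h1 : p.1 = 0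
      · by_cases h2 : q.1 = i - 1
        · simp [h1, h2]
        · simp only [h2, if_false, mul_zero]
          exact hHess _ _ (by simp only; omega)
      · simp only [h1, if_false, zero_mul]
        exact hHess _ _ (by simp only; omega)
    rw [this]
    exact Matrix.rank_vecMulVec_le _ _
  refine ⟨hlow, ?_⟩
  have key : H = Hᴴ + (Q * U) * (Q * V)ᴴ + (-(Q * V)) * (Q * U)ᴴ := by
    have hD : (Matrix.diagonal (fun i => (dd i : ℂ)))ᴴ
        = Matrix.diagonal (fun i => (dd i : ℂ)) := by
      rw [Matrix.diagonal_conjTranspose]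
      congr 1
      ext i
      simp
    rw [hH]
    simp only [Matrix.conjTranspose_mul, Matrix.conjTranspose_add,
      Matrix.conjTranspose_conjTranspose, hD, Matrix.mul_add, Matrix.add_mul,
      Matrix.neg_mul, Matrix.mul_assoc]
    abel
  intro i hi hin
  have hl := hlow i hi hin
  open scoped ComplexOrder in rw [← Matrix.rank_conjTranspose] at hl
  let f : Fin i → Fin n := fun p => ⟨p.1, by have := p.2; omega⟩
  let g : Fin (n - i) → Fin n := fun q => ⟨i + q.1, by have := q.2; omega⟩
  have h1 := rank_sub_mul_le_aux (Q * U) (Q * V)ᴴ f g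
  have h2 := rank_sub_mul_le_aux (-(Q * V)) (Q * U)ᴴ f g
  have hl' : (Hᴴ.submatrix f g).rank ≤ 1 := hl
  change (H.submatrix f g).rank ≤ 2 * k + 1
  have e : H.submatrix f g = Hᴴ.submatrix f g + ((Q * U) * (Q * V)ᴴ).submatrix f g
      + ((-(Q * V)) * (Q * U)ᴴ).submatrix f g := by
    exact congrArg (fun M => Matrix.submatrix M f g) key
  rw [e]
  have a1 := rank_add_le_aux (Hᴴ.submatrix f g + ((Q * U) * (Q * V)ᴴ).submatrix f g)
    (((-(Q * V)) * (Q * U)ᴴ).submatrix f g)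
  have a2 := rank_add_le_aux (Hᴴ.submatrix f g) (((Q * U) * (Q * V)ᴴ).submatrix f g)
  omega
end
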